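/- In the push-backward setting, the sequence B defined by B 0 = B₀ with 0 ≤ B₀ ≤ a₀ − e 0 and B (k+1) = min (B k) (A (k+1) − e (k+1)) is nonnegative and nonincreasing on 0, …, n; moreover, if B m = 0 for some m ≤ n, then the perturbed earliest-arrival schedule A' with start time a₀ − B₀ satisfies A' k = A k for all k with m ≤ k ≤ n. -/

import Mathlib

/-- The earliest-arrival schedule along a path with earliest times `e`, service times `s`,
travel times `t`, and start time `a₀`:  `A 0 = a₀` and
`A (k+1) = max (e (k+1)) (A k + s k + t k)`. -/
noncomputable def sched (e s t : ℕ → ℝ) (a₀ : ℝ) : ℕ → ℝ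
  | 0 => a₀
  | k + 1 => max (e (k + 1)) (sched e s t a₀ k + s k + t k)

/-- The push-backward values: `B 0 = B₀` and `B (k+1) = min (B k) (A (k+1) − e (k+1))`. -/
noncomputable def pushB (A e : ℕ → ℝ) (B₀ : ℝ) : ℕ → ℝ
  | 0 => B₀
  | k + 1 => min (pushB A e B₀ k) (A (k + 1) - e (k + 1))

theorem le_sched {e s t : ℕ → ℝ} {a₀ : ℝ} (ha : e 0 ≤ a₀) (k : ℕ) :
    e k ≤ sched e s t a₀ k := by
  cases k with
  | zero => exact ha
  | succ k => exact le_max_left _ _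

theorem pushB_nonneg {A e : ℕ → ℝ} {B₀ : ℝ} (hA : ∀ k, e k ≤ A k) (hB₀ : 0 ≤ B₀) (k : ℕ) :
    0 ≤ pushB A e B₀ k := by
  induction k with
  | zero => exact hB₀
  | succ k ih => exact le_min ih (sub_nonneg.2 (hA _))

theorem pushB_antitone (A e : ℕ → ℝ) (B₀ : ℝ) : Antitone (pushB A e B₀) :=
  antitone_nat_of_succ_le fun _ => min_le_left _ _

/-- Starting earlier by `B₀` moves the arrival at node `k` earlier by exactly `B k`. -/
theorem sched_sub_eq {e s t : ℕ → ℝ} {a₀ B₀ : ℝ} (ha : e 0 ≤ a₀) (hB₀ : 0 ≤ B₀) (k : ℕ) :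
    sched e s t (a₀ - B₀) k = sched e s t a₀ k - pushB (sched e s t a₀) e B₀ k := by
  induction k with
  | zero => rfl
  | succ k ih =>
    have hB := pushB_nonneg (le_sched (s := s) (t := t) ha) hB₀ k
    simp only [sched, pushB, ih]
    grind

/-- In the push-backward setting, the sequence `B` is nonnegative and nonincreasing on
`0, …, n`; moreover if `B m = 0` for some `m ≤ n`, then the perturbed earliest-arrival
schedule with start time `a₀ − B₀` agrees with `A` on `m, …, n`. -/
theorem push_backward_props (e l s t : ℕ → ℝ) (n : ℕ) (a₀ B₀ : ℝ)
    (hs : ∀ k, 0 ≤ s k) (ht : ∀ k, 0 ≤ t k)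
    (ha : e 0 ≤ a₀)
    (hl : ∀ k ≤ n, sched e s t a₀ k ≤ l k)
    (hB₀ : 0 ≤ B₀) (hB₀' : B₀ ≤ a₀ - e 0) :
    (∀ k ≤ n, 0 ≤ pushB (sched e s t a₀) e B₀ k) ∧
    (∀ j k, j ≤ k → k ≤ n →
      pushB (sched e s t a₀) e B₀ k ≤ pushB (sched e s t a₀) e B₀ j) ∧
    (∀ m ≤ n, pushB (sched e s t a₀) e B₀ m = 0 →
      ∀ k, m ≤ k → k ≤ n → sched e s t (a₀ - B₀) k = sched e s t a₀ k) := by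
  refine ⟨fun k _ => pushB_nonneg (le_sched ha) hB₀ k,
    fun j k hjk _ => pushB_antitone _ _ _ hjk, fun m _ hm k hmk _ => ?_⟩
  have hk : pushB (sched e s t a₀) e B₀ k = 0 :=
    le_antisymm (hm ▸ pushB_antitone _ _ _ hmk) (pushB_nonneg (le_sched ha) hB₀ k)
  rw [sched_sub_eq ha hB₀, hk, sub_zero]
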